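/- arXiv:1411.7879 — 10 statements merged into one kernel-verified Lean document; each statement's English description precedes it below -/
import Mathlib

section
/- Let V be a type with a symmetric reflexive adjacency relation ∼ and let L be a compatible lattice order on V. Then (1) for all u', u, v, v' in V, if u' ≤ u ≤ v ≤ v' and u' ∼ v', then u ∼ v (the min-max identity); and (2) for all u, v, w in V, if u ∼ v, v ∼ w, and either (u ≤ v and w ≤ v) or (v ≤ u and v ≤ w), then u ∼ w. -/
/-- A lattice order on `V` is compatible with the adjacency relation `adj` if meet and
join are polymorphisms. -/
def IsCompatible {V : Type*} [Lattice V] (adj : V → V → Prop) : Prop :=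
  ∀ u u' v v' : V, adj u u' → adj v v' →
    adj (u ⊓ v) (u' ⊓ v') ∧ adj (u ⊔ v) (u' ⊔ v')

theorem stmt0 {V : Type*} [Lattice V] (adj : V → V → Prop)
    (hsymm : ∀ u v, adj u v → adj v u) (hrefl : ∀ v, adj v v)
    (hcomp : IsCompatible adj) :
    (∀ u' u v v' : V, u' ≤ u → u ≤ v → v ≤ v' → adj u' v' → adj u v) ∧
    (∀ u v w : V, adj u v → adj v w →
      ((u ≤ v ∧ w ≤ v) ∨ (v ≤ u ∧ v ≤ w)) → adj u w) := by
  refine ⟨fun u' u v v' h₁ h₂ h₃ h => ?_, ?_⟩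
  · have huv' : adj u v' := by
      simpa [h₁, h₂.trans h₃] using (hcomp u' v' u u h (hrefl u)).2
    simpa [h₂, h₃] using (hcomp u v' v v huv' (hrefl v)).1
  · rintro u v w huv hvw (⟨hu, hw⟩ | ⟨hu, hw⟩)
    · simpa [hu, hw] using (hcomp u v v w huv hvw).1
    · simpa [hu, hw] using (hcomp u v v w huv hvw).2
end

section
/- Let (V,∼) be a connected reflexive graph with a compatible lattice order L. Then for every vertex v, the upset ↑v = {x : v ≤ x} induces a connected subgraph: for any u and w with v ≤ u and v ≤ w, there is a walk from u to w in which every vertex x satisfies v ≤ x (i.e., Relation.ReflTransGen of the restriction of ∼ to ↑v joins u and w). -/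
theorem stmt3 {V : Type*} [Lattice V] (adj : V → V → Prop)
    (hsymm : ∀ u v, adj u v → adj v u) (hrefl : ∀ v, adj v v)
    (hcomp : IsCompatible adj)
    (hconn : ∀ a b : V, Relation.ReflTransGen adj a b) :
    ∀ v u w : V, v ≤ u → v ≤ w →
      Relation.ReflTransGen (fun a b : V => adj a b ∧ v ≤ a ∧ v ≤ b) u w := by
  intro v u w hu hw
  have h := (hconn u w).lift (p := fun a b : V => adj a b ∧ v ≤ a ∧ v ≤ b) (· ⊔ v)
    fun a b hab => ⟨(hcomp a b v v hab (hrefl v)).2, le_sup_right, le_sup_right⟩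
  simpa only [Function.onFun, sup_eq_left.mpr hu, sup_eq_left.mpr hw] using h
end

section
/- Let (V,∼) be a connected reflexive graph with a compatible lattice order L. Then the Hasse diagram of L is a subgraph of the graph: for every cover relation v ⋖ u in L, the pair uv is an edge, i.e., v ∼ u. -/
theorem stmt4 {V : Type*} [Lattice V] (adj : V → V → Prop)
    (hsymm : ∀ u v, adj u v → adj v u) (hrefl : ∀ v, adj v v)
    (hcomp : IsCompatible adj)
    (hconn : ∀ a b : V, Relation.ReflTransGen adj a b) :
    ∀ u v : V, v ⋖ u → adj v u := by
  intro u v h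
  have retract_adj : ∀ {x y}, adj x y → adj ((x ⊔ v) ⊓ u) ((y ⊔ v) ⊓ u) := fun hxy =>
    (hcomp _ _ _ _ (hcomp _ _ _ _ hxy (hrefl v)).2 (hrefl u)).1
  have key : ∀ x, Relation.ReflTransGen adj v x → adj v u ∨ (x ⊔ v) ⊓ u = v := by
    intro x hx
    induction hx with
    | refl => simp [h.le]
    | tail _ hyz ih =>
      rcases ih with ih | ih
      · exact .inl ih
      · have hz := retract_adj hyz
        rw [ih] at hz
        rcases h.eq_or_eq (le_inf le_sup_right h.le) inf_le_right with hv | hu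
        · exact .inr hv
        · exact .inl (hu ▸ hz)
  rcases key u (hconn v u) with hvu | hvu
  · exact hvu
  · exact absurd (by simpa using hvu) h.ne'
end

section
/- Let (V,∼) be a connected reflexive graph with a compatible lattice order L, and let v be a degree-one vertex: there exists u ≠ v with v ∼ u, and every w with w ∼ v satisfies w = v or w = u. Then v must be the minimum or the maximum element of L: either v ≤ x for all x in V, or x ≤ v for all x in V. -/
theorem stmt5 {V : Type*} [Lattice V] (adj : V → V → Prop)
    (hsymm : ∀ u v, adj u v → adj v u) (hrefl : ∀ v, adj v v)
    (hcomp : IsCompatible adj)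
    (hconn : ∀ a b : V, Relation.ReflTransGen adj a b)
    (v u : V) (hu : u ≠ v) (hadj : adj v u)
    (hdeg : ∀ w : V, adj w v → w = v ∨ w = u) :
    (∀ x : V, v ≤ x) ∨ (∀ x : V, x ≤ v) := by
  have hcases : u ⊓ v = v ∨ u ⊓ v = u :=
    hdeg _ (by simpa using (hcomp u v v v (hsymm _ _ hadj) (hrefl v)).1)
  rcases hcases with h | h
  · left
    have hvu : v ≤ u := inf_eq_right.mp h
    intro x
    induction hconn v x with
    | refl => exact le_rfl
    | @tail b c _ hbc ih =>
      have key := (hcomp c b v v (hsymm _ _ hbc) (hrefl v)).1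
      rw [inf_eq_right.mpr ih] at key
      rcases hdeg _ key with hc | hc
      · exact inf_eq_right.mp hc
      · exact absurd (le_antisymm (hc ▸ inf_le_right) hvu) hu
  · right
    have huv : u ≤ v := inf_eq_left.mp h
    intro x
    induction hconn v x with
    | refl => exact le_rfl
    | @tail b c _ hbc ih =>
      have key := (hcomp c b v v (hsymm _ _ hbc) (hrefl v)).2
      rw [sup_eq_right.mpr ih] at key
      rcases hdeg _ key with hc | hc
      · exact sup_eq_right.mp hc
      · exact absurd (le_antisymm huv (hc ▸ le_sup_right)) hu
end

section
/- Let (V,∼) be a finite connected reflexive graph whose underlying loopless graph is a tree (the adjacency relation restricted to pairs of distinct vertices is the edge relation of a tree, i.e., connected and acyclic). If (V,∼) admits a compatible lattice order, then every vertex has at most two neighbours distinct from itself; in other words, the only reflexive trees admitting compatible lattices are reflexive paths. -/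
/-- An acyclic graph has no triangle. -/
theorem SimpleGraph.IsAcyclic.not_triangle {V : Type*} {G : SimpleGraph V} (h : G.IsAcyclic)
    {x y z : V} (hxy : G.Adj x y) (hyz : G.Adj y z) (hxz : G.Adj x z) : False := by
  have hcycle : (SimpleGraph.Walk.cons hxy (.cons hyz (.cons hxz.symm .nil))).IsCycle := by
    have := hxy.ne
    have := hyz.ne
    have := hxz.ne
    rw [SimpleGraph.Walk.cons_isCycle_iff]
    simp [SimpleGraph.Walk.cons_isPath_iff]
    grind
  exact h _ hcycle

/-- For a triangle-free relation compatible with a lattice, a vertex has at most one strict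
upper neighbour. -/
theorem IsCompatible.upper_neighbour_unique {V : Type*} [Lattice V] {adj : V → V → Prop}
    (hc : IsCompatible adj) (hrefl : ∀ v, adj v v)
    (htri : ∀ x y z, x ≠ y → y ≠ z → x ≠ z → adj x y → adj y z → adj x z → False)
    {v a b : V} (ha : adj v a) (hb : adj v b) (hva : v < a) (hvb : v < b) : a = b := by
  by_contra hab
  have h1 : adj a (a ⊔ b) := by
    simpa [sup_eq_left.2 hva.le] using (hc a a v b (hrefl a) hb).2
  have h2 : adj b (a ⊔ b) := by
    simpa [sup_eq_right.2 hvb.le] using (hc v a b b ha (hrefl b)).2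
  have h3 : adj v (a ⊔ b) := by simpa using (hc v a v b ha hb).2
  have hv : v ≠ a ⊔ b := (hva.trans_le le_sup_left).ne
  by_cases h : a = a ⊔ b
  · rw [← h] at h2
    exact htri v b a hvb.ne (Ne.symm hab) hva.ne hb h2 ha
  · exact htri v a (a ⊔ b) hva.ne h hv ha h1 h3

/-- The order dual of a compatible lattice is compatible. -/
theorem IsCompatible.dual {V : Type*} [Lattice V] {adj : V → V → Prop}
    (hc : IsCompatible adj) : IsCompatible (V := Vᵒᵈ) adj :=
  fun u u' v v' hu hv => (hc u u' v v' hu hv).symm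

/-- For a triangle-free relation compatible with a lattice, adjacent vertices are comparable. -/
theorem IsCompatible.lt_or_gt_of_adj {V : Type*} [Lattice V] {adj : V → V → Prop}
    (hc : IsCompatible adj) (hsymm : ∀ u v, adj u v → adj v u) (hrefl : ∀ v, adj v v)
    (htri : ∀ x y z, x ≠ y → y ≠ z → x ≠ z → adj x y → adj y z → adj x z → False)
    {u v : V} (h : adj u v) (hne : v ≠ u) : u < v ∨ v < u := by
  by_contra! hcon
  have h1 : adj u (u ⊓ v) := by simpa using (hc u u u v (hrefl u) h).1
  have h2 : adj v (u ⊓ v) := by simpa using (hc v u v v (hsymm _ _ h) (hrefl v)).1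
  refine htri u v (u ⊓ v) hne.symm (fun he => hcon.2 ?_) (fun he => hcon.1 ?_) h h2 h1
  · exact lt_of_le_of_ne (inf_eq_right.1 he.symm) hne
  · exact lt_of_le_of_ne (inf_eq_left.1 he.symm) hne.symm

theorem stmt6 {V : Type*} [Fintype V] (adj : V → V → Prop)
    (hsymm : ∀ u v, adj u v → adj v u) (hrefl : ∀ v, adj v v)
    (G : SimpleGraph V) (hG : ∀ x y, G.Adj x y ↔ x ≠ y ∧ adj x y)
    (htree : G.IsTree)
    (hlat : ∃ inst : Lattice V, @IsCompatible V inst adj) :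
    ∀ v : V, ({w | adj v w ∧ w ≠ v} : Set V).ncard ≤ 2 := by
  obtain ⟨_, hc⟩ := hlat
  have htri : ∀ x y z, x ≠ y → y ≠ z → x ≠ z → adj x y → adj y z → adj x z → False :=
    fun x y z hxy hyz hxz h1 h2 h3 => htree.isAcyclic.not_triangle
      ((hG x y).2 ⟨hxy, h1⟩) ((hG y z).2 ⟨hyz, h2⟩) ((hG x z).2 ⟨hxz, h3⟩)
  intro v
  by_contra! hcard
  obtain ⟨a, b, c, ⟨ha, hav⟩, ⟨hb, hbv⟩, ⟨hc', hcv⟩, hab, hac, hbc⟩ :=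
    (Set.two_lt_ncard_iff (Set.toFinite _)).1 hcard
  have hcmp {w : V} (h : adj v w) (hne : w ≠ v) : v < w ∨ w < v :=
    hc.lt_or_gt_of_adj hsymm hrefl htri h hne
  have hup {x y : V} (hx : adj v x) (hy : adj v y) (hvx : v < x) (hvy : v < y) : x = y :=
    hc.upper_neighbour_unique hrefl htri hx hy hvx hvy
  have hdown {x y : V} (hx : adj v x) (hy : adj v y) (hxv : x < v) (hyv : y < v) : x = y :=
    hc.dual.upper_neighbour_unique (V := Vᵒᵈ) hrefl htri hx hy hxv hyv
  rcases hcmp ha hav with h1 | h1 <;> rcases hcmp hb hbv with h2 | h2 <;>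
    rcases hcmp hc' hcv with h3 | h3
  all_goals first
    | exact hab (hup ha hb h1 h2)
    | exact hab (hdown ha hb h1 h2)
    | exact hac (hup ha hc' h1 h3)
    | exact hac (hdown ha hc' h1 h3)
    | exact hbc (hup hb hc' h2 h3)
    | exact hbc (hdown hb hc' h2 h3)
end

section
/- Let V = Fin 5 and let ∼ be the symmetric reflexive adjacency relation of the reflexive star K_{1,4}: 0 ∼ i for every i, every vertex is adjacent to itself, and distinct nonzero vertices are not adjacent. Then there is no lattice order on V compatible with this graph. -/
section Star

variable {V : Type*} [Lattice V] {adj : V → V → Prop} {c : V}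

/-- In a reflexive star with a compatible lattice order, every vertex is comparable with
the center. -/
theorem IsCompatible.star_comparable (h : IsCompatible adj)
    (hadj : ∀ x y, adj x y ↔ (x = y ∨ x = c ∨ y = c)) (a : V) : a ≤ c ∨ c ≤ a := by
  have h1 := (h c a a a ((hadj _ _).2 (by simp)) ((hadj _ _).2 (by simp))).1
  rw [hadj, inf_idem] at h1
  rcases h1 with h1 | h1 | h1
  · exact .inl (inf_eq_right.1 h1)
  · exact .inr (inf_eq_left.1 h1)
  · exact .inl h1.le

theorem IsCompatible.star_le_of_lt (h : IsCompatible adj)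
    (hadj : ∀ x y, adj x y ↔ (x = y ∨ x = c ∨ y = c)) {a : V} (ha : a < c) (b : V) :
    a ≤ b := by
  have h1 := (h c b a a ((hadj _ _).2 (by simp)) ((hadj _ _).2 (by simp))).1
  rw [hadj, inf_eq_right.2 ha.le] at h1
  rcases h1 with h1 | h1 | h1
  · exact inf_eq_right.1 h1.symm
  · exact absurd h1 ha.ne
  · exact absurd (h1 ▸ inf_le_right) ha.not_ge

theorem IsCompatible.star_le_of_gt (h : IsCompatible adj)
    (hadj : ∀ x y, adj x y ↔ (x = y ∨ x = c ∨ y = c)) {a : V} (ha : c < a) (b : V) :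
    b ≤ a := by
  have h1 := (h c b a a ((hadj _ _).2 (by simp)) ((hadj _ _).2 (by simp))).2
  rw [hadj, sup_eq_right.2 ha.le] at h1
  rcases h1 with h1 | h1 | h1
  · exact sup_eq_right.1 h1.symm
  · exact absurd h1 ha.ne'
  · exact absurd (h1 ▸ le_sup_right) ha.not_ge

/-- A reflexive star with a compatible lattice order has at most two leaves. -/
theorem IsCompatible.star_leaves (h : IsCompatible adj)
    (hadj : ∀ x y, adj x y ↔ (x = y ∨ x = c ∨ y = c)) {x y z : V}
    (hx : x ≠ c) (hy : y ≠ c) (hz : z ≠ c) : x = y ∨ x = z ∨ y = z := by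
  have key (a : V) (ha : a ≠ c) : a < c ∨ c < a :=
    (h.star_comparable hadj a).imp ha.lt_of_le ha.symm.lt_of_le
  have below {a b : V} (ha : a < c) (hb : b < c) : a = b :=
    (h.star_le_of_lt hadj ha b).antisymm (h.star_le_of_lt hadj hb a)
  have above {a b : V} (ha : c < a) (hb : c < b) : a = b :=
    (h.star_le_of_gt hadj hb a).antisymm (h.star_le_of_gt hadj ha b)
  rcases key x hx with h1 | h1 <;> rcases key y hy with h2 | h2 <;>
    rcases key z hz with h3 | h3 <;> grind

end Star

theorem stmt7 (adj : Fin 5 → Fin 5 → Prop)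
    (hdef : ∀ x y : Fin 5, adj x y ↔ (x = y ∨ x = 0 ∨ y = 0)) :
    ¬ ∃ inst : Lattice (Fin 5), @IsCompatible (Fin 5) inst adj := by
  rintro ⟨inst, h⟩
  have := @IsCompatible.star_leaves (Fin 5) inst adj 0 h hdef 1 2 3
    (by decide) (by decide) (by decide)
  revert this
  decide
end

section
/- Let P be a partial order and A a relation on P contained in ≤. Suppose the arc (x',y') (with x' ≤ y') is useless in A: there exist x, y with x' ≤ x ≤ y ≤ y', (x,y) ≠ (x',y'), and ¬A x y. Then adding or removing the arc (x',y') does not change the graph G(P,A): for all lower sets D, D' of P, D and D' are adjacent in G(P,A) if and only if they are adjacent in G(P,A'), where A' is A together with the arc (x',y'). -/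
/-- The graph `G(P,A)` on the lower sets of `P`: two lower sets `D`, `D'` are adjacent
exactly when `A` contains every arc `(x,y)` of `P` (i.e. pair with `x ≤ y`) such that
`x` and `y` both lie in `D \ D'` or both lie in `D' \ D`. -/
def GPAadj {P : Type*} [Preorder P] (A : P → P → Prop) (D D' : LowerSet P) : Prop :=
  ∀ x y : P, x ≤ y →
    ((x ∈ D ∧ x ∉ D' ∧ y ∈ D ∧ y ∉ D') ∨ (x ∈ D' ∧ x ∉ D ∧ y ∈ D' ∧ y ∉ D)) →
    A x y

theorem stmt9 {P : Type*} [PartialOrder P] (A : P → P → Prop)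
    (hA : ∀ x y, A x y → x ≤ y) (x' y' : P) (hx'y' : x' ≤ y')
    (huseless : ∃ x y : P, x' ≤ x ∧ x ≤ y ∧ y ≤ y' ∧ (x, y) ≠ (x', y') ∧ ¬ A x y) :
    ∀ D D' : LowerSet P,
      GPAadj A D D' ↔ GPAadj (fun a b => A a b ∨ (a = x' ∧ b = y')) D D' := by
  obtain ⟨x, y, hx, hxy, hy, hne, hnA⟩ := huseless
  intro D D'
  refine ⟨fun h a b hab hD => Or.inl (h a b hab hD), fun h a b hab hD => ?_⟩
  rcases h a b hab hD with hAab | ⟨rfl, rfl⟩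
  · exact hAab
  -- `D \ D'` and `D' \ D` are order-convex, so they contain `x` and `y` as well.
  have hconv : ∀ E E' : LowerSet P, a ∉ E' → b ∈ E → x ∈ E ∧ x ∉ E' ∧ y ∈ E ∧ y ∉ E' :=
    fun E E' ha hb => ⟨E.lower (hxy.trans hy) hb, fun hxE => ha (E'.lower hx hxE),
      E.lower hy hb, fun hyE => ha (E'.lower (hx.trans hxy) hyE)⟩
  have hxyD := hD.imp (fun ⟨_, ha, hb, _⟩ => hconv D D' ha hb)
    (fun ⟨_, ha, hb, _⟩ => hconv D' D ha hb)
  rcases h x y hxy hxyD with hAxy | ⟨hxa, hyb⟩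
  · exact absurd hAxy hnA
  · exact absurd (Prod.ext hxa hyb) hne
end

section
/- Let P be a partial order and A a relation on P contained in ≤. Then the distributive lattice of lower sets of P (ordered by inclusion, with meet ∩ and join ∪) is compatible with the graph G(P,A): the adjacency relation of G(P,A) is symmetric and reflexive, and whenever D₁ is adjacent to D₁' and D₂ is adjacent to D₂' in G(P,A), also D₁ ∪ D₂ is adjacent to D₁' ∪ D₂' and D₁ ∩ D₂ is adjacent to D₁' ∩ D₂'. -/
theorem stmt11 {P : Type*} [PartialOrder P] (A : P → P → Prop)
    (hA : ∀ x y, A x y → x ≤ y) :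
    (∀ D D' : LowerSet P, GPAadj A D D' → GPAadj A D' D) ∧
    (∀ D : LowerSet P, GPAadj A D D) ∧
    (∀ D₁ D₁' D₂ D₂' : LowerSet P, GPAadj A D₁ D₁' → GPAadj A D₂ D₂' →
      GPAadj A (D₁ ⊔ D₂) (D₁' ⊔ D₂') ∧ GPAadj A (D₁ ⊓ D₂) (D₁' ⊓ D₂')) := by
  refine ⟨fun D D' h x y hxy hd => h x y hxy hd.symm, fun D x y _ hd => ?_,
    fun D₁ D₁' D₂ D₂' h₁ h₂ => ⟨fun x y hxy hd => ?_, fun x y hxy hd => ?_⟩⟩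
  · tauto
  all_goals
    have l₁ : y ∈ D₁ → x ∈ D₁ := D₁.lower hxy
    have l₁' : y ∈ D₁' → x ∈ D₁' := D₁'.lower hxy
    have l₂ : y ∈ D₂ → x ∈ D₂ := D₂.lower hxy
    have l₂' : y ∈ D₂' → x ∈ D₂' := D₂'.lower hxy
    have a₁ := h₁ x y hxy
    have a₂ := h₂ x y hxy
    simp only [LowerSet.mem_sup_iff, LowerSet.mem_inf_iff] at hd
    clear h₁ h₂ hA
    grind
end

section
/- Let V be a finite type with a symmetric reflexive adjacency relation ∼ and a compatible distributive lattice order L. Let J be the set of join-irreducible elements of L, with the induced partial order, and let e be Birkhoff's order isomorphism from L onto the lattice of lower sets of J, given by e(x) = {a ∈ J : a ≤ x}. Then there exists a relation A on J, contained in ≤, such that for all x, y in V: x ∼ y if and only if e(x) and e(y) are adjacent in G(J,A). Moreover A is unique among relations contained in ≤ that satisfy the directed min-max condition: a' ≤ a ≤ b ≤ b' and A a' b' imply A a b. -/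
/-- Birkhoff's map: `x ↦ {a join-irreducible : a ≤ x}`, a lower set of the poset of
join-irreducibles. -/
def birkhoffMap {V : Type*} [DistribLattice V] (x : V) :
    LowerSet {a : V // SupIrred a} :=
  ⟨{a | (a : V) ≤ x}, fun a b hba ha => le_trans (Subtype.coe_le_coe.mpr hba) ha⟩

theorem exists_supIrred_le_not_le {V : Type*} [Finite V] [Lattice V] {x y : V}
    (h : ¬ x ≤ y) : ∃ p : V, SupIrred p ∧ p ≤ x ∧ ¬ p ≤ y := by
  obtain ⟨p, -, hp⟩ := (Set.toFinite {w : V | w ≤ x ∧ ¬ w ≤ y}).exists_le_minimal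
    (show x ∈ {w : V | w ≤ x ∧ ¬ w ≤ y} from ⟨le_rfl, h⟩)
  refine ⟨p, ⟨fun hmin => hp.prop.2 ((hmin inf_le_left).trans inf_le_right), ?_⟩, hp.prop⟩
  intro b c hbc
  by_contra! hne
  have below : ∀ d, d ≤ p → d ≠ p → d ≤ y := fun d hd hdp => by
    by_contra hdy
    exact hdp (hd.antisymm (hp.le_of_le ⟨hd.trans hp.prop.1, hdy⟩ hd))
  exact hp.prop.2 (hbc ▸ sup_le (below b (hbc ▸ le_sup_left) hne.1)
    (below c (hbc ▸ le_sup_right) hne.2))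

/-- The pair `a ≤ b` is such that some element adjacent to `b` is not above `a`. -/
def HasAdjNotAbove {V : Type*} [LE V] (adj : V → V → Prop) (a b : V) : Prop :=
  a ≤ b ∧ ∃ z, adj b z ∧ ¬ a ≤ z

theorem IsCompatible.adj_inf_of_supIrred {V : Type*} [Finite V] [DistribLattice V]
    {adj : V → V → Prop} (hcomp : IsCompatible adj) (hrefl : ∀ v, adj v v) {q y : V}
    (h : ∀ p, SupIrred p → p ≤ q → ¬ p ≤ y → HasAdjNotAbove adj p q) :
    adj q (q ⊓ y) := by
  obtain ⟨z, -, hz⟩ := (Set.toFinite {z : V | adj q z ∧ q ⊓ y ≤ z ∧ z ≤ q}).exists_le_minimal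
    (show q ∈ {z : V | adj q z ∧ q ⊓ y ≤ z ∧ z ≤ q} from ⟨hrefl q, inf_le_left, le_rfl⟩)
  obtain ⟨hqz, hyz, hzq⟩ := hz.prop
  suffices hzy : z ≤ y by rwa [hyz.antisymm (le_inf hzq hzy)]
  by_contra hzy
  obtain ⟨p, hp, hpz, hpy⟩ := exists_supIrred_le_not_le hzy
  obtain ⟨-, w, hqw, hpw⟩ := h p hp (hpz.trans hzq) hpy
  have hadj : adj q (z ⊓ (w ⊔ q ⊓ y)) := by
    have h₁ := (hcomp _ _ _ _ hqw (hrefl (q ⊓ y))).2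
    have h₂ := (hcomp _ _ _ _ hqz h₁).1
    rwa [sup_inf_self, inf_idem] at h₂
  have hle : z ≤ w ⊔ q ⊓ y :=
    (hz.le_of_le ⟨hadj, le_inf hyz le_sup_right, inf_le_left.trans hzq⟩
      inf_le_left).trans inf_le_right
  rcases hp.supPrime.2 (hpz.trans hle) with h' | h'
  · exact hpw h'
  · exact hpy (h'.trans inf_le_right)

theorem IsCompatible.adj_inf {V : Type*} [Finite V] [DistribLattice V]
    {adj : V → V → Prop} (hcomp : IsCompatible adj) (hrefl : ∀ v, adj v v) {x y : V}
    (h : ∀ p q, SupIrred p → SupIrred q → p ≤ q → q ≤ x → ¬ p ≤ y → HasAdjNotAbove adj p q) :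
    adj x (x ⊓ y) := by
  obtain ⟨w, -, hw⟩ := (Set.toFinite {w : V | w ≤ x ∧ adj w (w ⊓ y)}).exists_le_maximal
    (show x ⊓ y ∈ {w : V | w ≤ x ∧ adj w (w ⊓ y)} from
      ⟨inf_le_left, by rw [inf_assoc, inf_idem]; exact hrefl _⟩)
  suffices hxw : x ≤ w by
    rw [hxw.antisymm hw.prop.1]
    exact hw.prop.2
  by_contra hxw
  obtain ⟨q, hq, hqx, hqw⟩ := exists_supIrred_le_not_le hxw
  have hqy := hcomp.adj_inf_of_supIrred hrefl fun p hp hpq hpy => h p q hp hq hpq hqx hpy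
  have hsup := (hcomp _ _ _ _ hw.prop.2 hqy).2
  rw [← inf_sup_right] at hsup
  exact hqw (le_sup_right.trans (hw.le_of_ge ⟨sup_le hw.prop.1 hqx, hsup⟩ le_sup_left))

theorem IsCompatible.hasAdjNotAbove_of_adj {V : Type*} [Lattice V] {adj : V → V → Prop}
    (hcomp : IsCompatible adj) (hrefl : ∀ v, adj v v) {x y p q : V} (hxy : adj x y)
    (hpq : p ≤ q) (hqx : q ≤ x) (hpy : ¬ p ≤ y) : HasAdjNotAbove adj p q := by
  refine ⟨hpq, q ⊓ y, ?_, fun h => hpy (h.trans inf_le_right)⟩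
  simpa [hqx] using (hcomp _ _ _ _ (hrefl q) hxy).1

theorem IsCompatible.adj_iff_GPAadj {V : Type*} [Finite V] [DistribLattice V]
    {adj : V → V → Prop} (hcomp : IsCompatible adj) (hsymm : ∀ u v, adj u v → adj v u)
    (hrefl : ∀ v, adj v v) (x y : V) :
    adj x y ↔ GPAadj (fun a b : {a : V // SupIrred a} => HasAdjNotAbove adj (a : V) b)
      (birkhoffMap x) (birkhoffMap y) := by
  constructor
  · rintro hxy p q hpq (⟨-, hpy, hqx, -⟩ | ⟨-, hpx, hqy, -⟩)
    · exact hcomp.hasAdjNotAbove_of_adj hrefl hxy hpq hqx hpy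
    · exact hcomp.hasAdjNotAbove_of_adj hrefl (hsymm _ _ hxy) hpq hqy hpx
  · intro h
    have hx : adj x (x ⊓ y) := hcomp.adj_inf hrefl fun p q hp hq hpq hqx hpy =>
      h ⟨p, hp⟩ ⟨q, hq⟩ hpq
        (Or.inl ⟨hpq.trans hqx, hpy, hqx, fun hqy => hpy (hpq.trans hqy)⟩)
    have hy : adj y (y ⊓ x) := hcomp.adj_inf hrefl fun p q hp hq hpq hqy hpx =>
      h ⟨p, hp⟩ ⟨q, hq⟩ hpq
        (Or.inr ⟨hpq.trans hqy, hpx, hqy, fun hqx => hpx (hpq.trans hqx)⟩)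
    have hxy := (hcomp _ _ _ _ hx (hsymm _ _ hy)).2
    rwa [inf_comm y x, sup_inf_self, sup_comm (x ⊓ y), inf_comm x y, sup_inf_self] at hxy

/-- A maximal `z ≤ b` not above a join-prime `a`: every `p ≤ b` outside `z` is above `a`. -/
theorem SupPrime.exists_le_not_le {V : Type*} [Finite V] [Lattice V] {a b : V}
    (ha : SupPrime a) (hab : a ≤ b) :
    ∃ z ≤ b, ¬ a ≤ z ∧ ∀ p ≤ b, ¬ p ≤ z → a ≤ p := by
  obtain ⟨c, hca⟩ := not_isMin_iff.1 ha.1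
  obtain ⟨z, -, hz⟩ := (Set.toFinite {z : V | z ≤ b ∧ ¬ a ≤ z}).exists_le_maximal
    (show c ∈ {z : V | z ≤ b ∧ ¬ a ≤ z} from ⟨hca.le.trans hab, hca.not_ge⟩)
  refine ⟨z, hz.prop.1, hz.prop.2, fun p hpb hpz => ?_⟩
  have hazp : a ≤ z ⊔ p := by
    by_contra hazp
    exact hpz (le_sup_right.trans (hz.le_of_ge ⟨sup_le hz.prop.1 hpb, hazp⟩ le_sup_left))
  exact (ha.2 hazp).resolve_left hz.prop.2

theorem stmt12 {V : Type*} [Fintype V] [DistribLattice V] (adj : V → V → Prop)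
    (hsymm : ∀ u v, adj u v → adj v u) (hrefl : ∀ v, adj v v)
    (hcomp : IsCompatible adj) :
    ∃ A : {a : V // SupIrred a} → {a : V // SupIrred a} → Prop,
      (∀ a b, A a b → a ≤ b) ∧
      (∀ a b a' b', a' ≤ a → a ≤ b → b ≤ b' → A a' b' → A a b) ∧
      (∀ x y : V, adj x y ↔ GPAadj A (birkhoffMap x) (birkhoffMap y)) ∧
      (∀ A' : {a : V // SupIrred a} → {a : V // SupIrred a} → Prop,
        (∀ a b, A' a b → a ≤ b) →
        (∀ a b a' b', a' ≤ a → a ≤ b → b ≤ b' → A' a' b' → A' a b) →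
        (∀ x y : V, adj x y ↔ GPAadj A' (birkhoffMap x) (birkhoffMap y)) →
        A' = A) := by
  refine ⟨fun a b => HasAdjNotAbove adj (a : V) b, fun _ _ h => h.1, ?_,
    hcomp.adj_iff_GPAadj hsymm hrefl, ?_⟩
  · rintro a b a' b' ha'a hab hbb' ⟨-, z, hz, ha'z⟩
    exact hcomp.hasAdjNotAbove_of_adj hrefl hz hab hbb' fun h => ha'z (le_trans ha'a h)
  · intro A' hle hmono hadj
    funext a b
    refine propext ⟨fun h => ⟨hle a b h, ?_⟩, ?_⟩
    · obtain ⟨z, hzb, haz, hz⟩ := a.2.supPrime.exists_le_not_le (hle a b h)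
      refine ⟨z, (hadj b z).2 ?_, haz⟩
      rintro p q hpq (⟨hpb, hpz, hqb, -⟩ | ⟨hpz, hpb, -⟩)
      · exact hmono p q a b (hz p hpb hpz) hpq hqb h
      · exact absurd (le_trans hpz hzb) hpb
    · rintro ⟨hab, z, hbz, haz⟩
      exact (hadj b z).1 hbz a b hab
        (Or.inl ⟨hab, haz, le_refl (b : V), fun hbz' => haz (hab.trans hbz')⟩)
end

section
/- Let ι be a finite index type, and for each i ∈ ι let Cᵢ be a finite linear order and ∼ᵢ a symmetric reflexive relation on Cᵢ satisfying the min-max identity (a proper interval graph in min-max form). Let K be a finite set and for each k ∈ K let i_k, j_k ∈ ι, α_k ∈ C_{i_k} and β_k ∈ C_{j_k}, and define the vertex interval V_k = {x ∈ ∏ᵢ Cᵢ : α_k ≤ x(i_k) and x(j_k) ≤ β_k}. Let S = (∏ᵢ Cᵢ) \ ⋃_{k∈K} V_k. Then: (1) S is closed under componentwise join and componentwise meet, so the componentwise order makes S a distributive lattice; and (2) this distributive lattice is compatible with the induced subgraph of the product graph on S, where x ∼ y means x(i) ∼ᵢ y(i) for every i ∈ ι. In particular, any induced subgraph of a product of proper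 interval graphs in min-max form obtained by removing vertex intervals is a distributive lattice graph. -/
theorem rel_inf_of_minmax {L : Type*} [LinearOrder L] {r : L → L → Prop}
    (hsymm : ∀ a b, r a b → r b a)
    (hminmax : ∀ u' u v v' : L, u' ≤ u → u ≤ v → v ≤ v' → r u' v' → r u v)
    {a a' b b' : L} (ha : r a a') (hb : r b b') : r (a ⊓ b) (a' ⊓ b') := by
  wlog hab : a ≤ b generalizing a a' b b'
  · rw [inf_comm a, inf_comm a']
    exact this hb ha (le_of_not_ge hab)
  rw [inf_eq_left.2 hab]
  rcases le_total a' b' with h | h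
  · rwa [inf_eq_left.2 h]
  rw [inf_eq_right.2 h]
  rcases le_total a b' with h' | h'
  · exact hminmax a a b' a' le_rfl h' h ha
  · exact hsymm _ _ (hminmax b' b' a b le_rfl h' hab (hsymm _ _ hb))

theorem rel_sup_of_minmax {L : Type*} [LinearOrder L] {r : L → L → Prop}
    (hsymm : ∀ a b, r a b → r b a)
    (hminmax : ∀ u' u v v' : L, u' ≤ u → u ≤ v → v ≤ v' → r u' v' → r u v)
    {a a' b b' : L} (ha : r a a') (hb : r b b') : r (a ⊔ b) (a' ⊔ b') :=
  rel_inf_of_minmax (L := Lᵒᵈ) (r := r) hsymm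
    (fun u' u v v' h₁ h₂ h₃ h => hsymm _ _ (hminmax v' v u u' h₃ h₂ h₁ (hsymm _ _ h))) ha hb


theorem stmt15 {ι : Type*} [Fintype ι] (C : ι → Type*)
    [∀ i, LinearOrder (C i)] [∀ i, Fintype (C i)]
    (sim : ∀ i, C i → C i → Prop)
    (hsymm : ∀ i a b, sim i a b → sim i b a)
    (hrefl : ∀ i a, sim i a a)
    (hminmax : ∀ i, ∀ u' u v v' : C i, u' ≤ u → u ≤ v → v ≤ v' →
      sim i u' v' → sim i u v)
    (K : Type*) [Fintype K] (ik jk : K → ι)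
    (α : ∀ k : K, C (ik k)) (β : ∀ k : K, C (jk k))
    (S : Set (∀ i, C i))
    (hS : S = {x | ¬ ∃ k : K, α k ≤ x (ik k) ∧ x (jk k) ≤ β k}) :
    (∀ x y : ∀ i, C i, x ∈ S → y ∈ S → x ⊔ y ∈ S ∧ x ⊓ y ∈ S) ∧
    (∀ x x' y y' : ∀ i, C i, x ∈ S → x' ∈ S → y ∈ S → y' ∈ S →
      (∀ i, sim i (x i) (x' i)) → (∀ i, sim i (y i) (y' i)) →
      (∀ i, sim i ((x ⊓ y) i) ((x' ⊓ y') i)) ∧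
      (∀ i, sim i ((x ⊔ y) i) ((x' ⊔ y') i))) := by
  subst hS
  refine ⟨fun x y hx hy => ⟨?_, ?_⟩, fun x x' y y' _ _ _ _ hx hy => ⟨fun i => ?_, fun i => ?_⟩⟩
  · rintro ⟨k, hα, hβ⟩
    obtain ⟨hβx, hβy⟩ := sup_le_iff.1 hβ
    exact (le_sup_iff.1 hα).elim (fun h => hx ⟨k, h, hβx⟩) (fun h => hy ⟨k, h, hβy⟩)
  · rintro ⟨k, hα, hβ⟩
    obtain ⟨hαx, hαy⟩ := le_inf_iff.1 hα
    exact (inf_le_iff.1 hβ).elim (fun h => hx ⟨k, hαx, h⟩) (fun h => hy ⟨k, hαy, h⟩)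
  · exact rel_inf_of_minmax (hsymm i) (hminmax i) (hx i) (hy i)
  · exact rel_sup_of_minmax (hsymm i) (hminmax i) (hx i) (hy i)
end
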